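/- arXiv:1005.0129 — 5 statements merged into one kernel-verified Lean document; each statement's English description precedes it below -/
import Mathlib

section
/- For every integer n ≥ 3, the automaton 𝒲_n is synchronizing and its reset length (the minimum length of a reset word) is exactly n² − 3n + 3. -/
/-- The two input letters of the automaton. -/
inductive Letter | a | b

/-- Transition function of the automaton `𝒲ₙ` on states `{1, …, n}`:
`δ(i,a) = δ(i,b) = i+1` for `1 ≤ i ≤ n-1`, `δ(n,a) = 2`, `δ(n,b) = 1`. -/
def delta (n : ℕ) (q : ℕ) : Letter → ℕ
  | Letter.a => if q < n then q + 1 else 2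
  | Letter.b => if q < n then q + 1 else 1

/-- `w` is a reset word: it sends every state in `{1, …, n}` to one single state. -/
def IsReset (n : ℕ) (w : List Letter) : Prop :=
  ∃ p : ℕ, ∀ q ∈ Finset.Icc 1 n, w.foldl (delta n) q = p

theorem delta_mem {n q : ℕ} (hn : 2 ≤ n) (hq : 1 ≤ q ∧ q ≤ n) (c : Letter) :
    1 ≤ delta n q c ∧ delta n q c ≤ n := by
  cases c <;> simp only [delta] <;> split_ifs <;> omega

theorem foldl_delta_mem {n : ℕ} (hn : 2 ≤ n) (w : List Letter) {q : ℕ} (hq : 1 ≤ q ∧ q ≤ n) :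
    1 ≤ w.foldl (delta n) q ∧ w.foldl (delta n) q ≤ n := by
  induction w generalizing q with
  | nil => exact hq
  | cons c w ih => exact ih (delta_mem hn hq c)

/-- The only pair of states merged by a letter is `{1, n}`, and it is sent to `2`. -/
theorem delta_eq_two_of_merge {n q r : ℕ} (hq : 1 ≤ q ∧ q ≤ n) (hr : 1 ≤ r ∧ r ≤ n)
    (hne : q ≠ r) {c : Letter} (h : delta n q c = delta n r c) : delta n q c = 2 := by
  cases c <;> simp only [delta] at h ⊢ <;> split_ifs at h ⊢ <;> omega

/-- A word leading from `1` to `s` traverses a path of length `s - 1` together with cycles of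
lengths `n` and `n - 1`. -/
theorem length_add_one_eq {n : ℕ} (hn : 2 ≤ n) (w : List Letter) :
    ∃ x y : ℕ, w.length + 1 = w.foldl (delta n) 1 + x * n + y * (n - 1) := by
  induction w using List.reverseRecOn with
  | nil => exact ⟨0, 0, by simp⟩
  | append_singleton w c ih =>
    obtain ⟨x, y, h⟩ := ih
    have hs := foldl_delta_mem hn w (q := 1) (by omega)
    rw [List.foldl_append, List.length_append]
    simp only [List.foldl_cons, List.foldl_nil, List.length_singleton]
    generalize w.foldl (delta n) 1 = s at *
    by_cases hlt : s < n
    · refine ⟨x, y, ?_⟩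
      cases c <;> simp only [delta, if_pos hlt] <;> omega
    · cases c
      · refine ⟨x, y + 1, ?_⟩
        simp only [delta, if_neg hlt, add_mul]
        omega
      · refine ⟨x + 1, y, ?_⟩
        simp only [delta, if_neg hlt, add_mul]
        omega

/-- Every reset word has a prefix resetting the automaton to the state `2`. -/
theorem IsReset.exists_reset_to_two {n : ℕ} (hn : 2 ≤ n) {w : List Letter} (hw : IsReset n w) :
    ∃ v : List Letter, v.length ≤ w.length ∧
      ∀ q, 1 ≤ q ∧ q ≤ n → v.foldl (delta n) q = 2 := by
  induction w using List.reverseRecOn with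
  | nil =>
    obtain ⟨p, hp⟩ := hw
    have h1 := hp 1 (by simp; omega)
    have h2 := hp 2 (by simp; omega)
    simp only [List.foldl_nil] at h1 h2
    omega
  | append_singleton w c ih =>
    by_cases hr : IsReset n w
    · obtain ⟨v, hv, h⟩ := ih hr
      exact ⟨v, by simp; omega, h⟩
    · obtain ⟨p, hp⟩ := hw
      have h1 := foldl_delta_mem hn w (q := 1) (by omega)
      have hex : ∃ q, (1 ≤ q ∧ q ≤ n) ∧ w.foldl (delta n) q ≠ w.foldl (delta n) 1 := by
        by_contra! hcon
        exact hr ⟨_, fun q hq => hcon q (Finset.mem_Icc.mp hq)⟩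
      obtain ⟨q, hq, hne⟩ := hex
      have hp1 := hp 1 (by simp; omega)
      have hpq := hp q (Finset.mem_Icc.mpr hq)
      have htwo : p = 2 := by
        rw [← hpq, List.foldl_append]
        rw [← hp1, List.foldl_append, List.foldl_append] at hpq
        exact delta_eq_two_of_merge (foldl_delta_mem hn w hq) h1 hne hpq
      exact ⟨w ++ [c], le_rfl, fun r hr' => (hp r (Finset.mem_Icc.mpr hr')).trans htwo⟩

theorem IsReset.length_ge {n : ℕ} (hn : 3 ≤ n) {w : List Letter} (hw : IsReset n w) :
    n ^ 2 - 3 * n + 3 ≤ w.length := by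
  obtain ⟨v, hvw, hv⟩ := hw.exists_reset_to_two (by omega)
  refine le_trans ?_ hvw
  by_contra! hlt
  obtain ⟨m, rfl⟩ := Nat.exists_eq_add_of_le' hn
  have hsq : (m + 3) ^ 2 - 3 * (m + 3) + 3 = m * m + 3 * m + 3 := by
    have : (m + 3) ^ 2 = m * m + 3 * m + 3 * (m + 3) := by ring
    omega
  rw [hsq] at hlt
  -- Padding on the left yields a walk from `1` to `2` of length one above the Frobenius number.
  set u := List.replicate (m * m + 3 * m + 2 - v.length) Letter.b with hu
  obtain ⟨x, y, h⟩ := length_add_one_eq (n := m + 3) (by omega) (u ++ v)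
  rw [List.foldl_append, hv _ (foldl_delta_mem (by omega) u (by omega)), List.length_append,
    hu, List.length_replicate] at h
  have hcop : Nat.Coprime (m + 3) (m + 2) :=
    ((Nat.coprime_self_add_right (m := m + 2) (n := 1)).2 (by simp)).symm
  refine hcop.mul_add_mul_ne_mul (a := x + 1) (b := y + 1) (by omega) (by omega) ?_
  have h' : m * m + 3 * m + 3 = 2 + x * (m + 3) + y * (m + 2) := by
    have e : m + 3 - 1 = m + 2 := by omega
    rw [e] at h
    omega
  linarith

theorem foldl_replicate_b {n : ℕ} (k : ℕ) (hk : k ≤ n) {q : ℕ} (hq : 1 ≤ q ∧ q ≤ n) :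
    (List.replicate k Letter.b).foldl (delta n) q = if q + k ≤ n then q + k else q + k - n := by
  induction k with
  | zero => simp [hq.2]
  | succ k ih =>
    rw [List.replicate_succ', List.foldl_append, ih (by omega)]
    simp only [List.foldl_cons, List.foldl_nil, delta]
    split_ifs <;> omega

/-- The word `a b^(n-2)` fixes `n` and decreases the other states cyclically. -/
theorem foldl_a_replicate_b {n : ℕ} (hn : 3 ≤ n) {q : ℕ} (hq : 1 ≤ q ∧ q ≤ n) :
    (Letter.a :: List.replicate (n - 2) Letter.b).foldl (delta n) q =
      if q = 1 ∨ q = n then n else q - 1 := by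
  rw [List.foldl_cons, foldl_replicate_b _ (by omega) (delta_mem (by omega) hq _)]
  simp only [delta]
  split_ifs <;> omega

theorem foldl_flatten_replicate {n : ℕ} (hn : 3 ≤ n) (k : ℕ) {q : ℕ} (hq : 1 ≤ q ∧ q ≤ n) :
    (List.replicate k (Letter.a :: List.replicate (n - 2) Letter.b)).flatten.foldl (delta n) q =
      if q ≤ k ∨ q = n then n else q - k := by
  induction k with
  | zero => simp; omega
  | succ k ih =>
    rw [List.replicate_succ', List.flatten_append, List.foldl_append, ih, List.flatten_singleton,
      foldl_a_replicate_b hn (by split_ifs <;> omega)]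
    split_ifs <;> omega

theorem exists_reset_word {n : ℕ} (hn : 3 ≤ n) :
    ∃ w : List Letter, IsReset n w ∧ w.length = n ^ 2 - 3 * n + 3 := by
  refine ⟨(List.replicate (n - 2)
    (Letter.a :: List.replicate (n - 2) Letter.b)).flatten ++ [Letter.a], ⟨2, fun q hq => ?_⟩, ?_⟩
  · have hq' := Finset.mem_Icc.mp hq
    rw [List.foldl_append, foldl_flatten_replicate hn _ hq']
    simp only [List.foldl_cons, List.foldl_nil, delta]
    split_ifs <;> omega
  · obtain ⟨m, rfl⟩ := Nat.exists_eq_add_of_le' hn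
    have hsq : (m + 3) ^ 2 = m * m + 6 * m + 9 := by ring
    have hmul : (m + 1) * (m + 1 + 1) = m * m + 3 * m + 2 := by ring
    have e : m + 3 - 2 = m + 1 := by omega
    simp only [List.length_append, List.length_flatten, List.map_replicate, List.sum_replicate,
      List.length_cons, List.length_replicate, List.length_nil, smul_eq_mul, e, hsq, hmul]
    omega

/-- `𝒲ₙ` is synchronizing and its reset length is exactly `n² - 3n + 3`. -/
theorem wielandt_automaton_reset_length (n : ℕ) (hn : 3 ≤ n) :
    IsLeast {L : ℕ | ∃ w : List Letter, IsReset n w ∧ w.length = L}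
      (n ^ 2 - 3 * n + 3) := by
  refine ⟨exists_reset_word hn, ?_⟩
  rintro L ⟨w, hw, rfl⟩
  exact hw.length_ge hn
end

section
/- For every integer n ≥ 3, the word (a b^{n−2})^{n−2} a, of length (n−1)(n−2) + 1 = n² − 3n + 3, is a reset word for the automaton 𝒲_n. -/
/-- The word `(a b^{n-2})^{n-2} a`. -/
def theWord (n : ℕ) : List Letter :=
  (List.replicate (n - 2) (Letter.a :: List.replicate (n - 2) Letter.b)).flatten ++ [Letter.a]

/-- The letter `b` acts as the cyclic shift of `{1, …, n}`. -/
theorem foldl_delta_replicate_b {n q k : ℕ} (hqn : q ≤ n) (hk : k ≤ n) :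
    (List.replicate k Letter.b).foldl (delta n) q =
      if q + k ≤ n then q + k else q + k - n := by
  induction k with
  | zero => simp [hqn]
  | succ k ih =>
    rw [List.replicate_succ', List.foldl_append, ih (by omega)]
    simp only [List.foldl_cons, List.foldl_nil, delta]
    split_ifs <;> omega

/-- The word `a b^{n-2}` fixes `n`, sends `1` to `n`, and decreases every other state by one. -/
theorem foldl_delta_block {n q : ℕ} (hn : 3 ≤ n) (hq : 1 ≤ q) (hqn : q ≤ n) :
    (Letter.a :: List.replicate (n - 2) Letter.b).foldl (delta n) q =
      if q = n ∨ q = 1 then n else q - 1 := by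
  rw [List.foldl_cons]
  by_cases h : q < n
  · rw [show delta n q Letter.a = q + 1 from if_pos h,
      foldl_delta_replicate_b (by omega) (by omega)]
    split_ifs <;> omega
  · rw [show delta n q Letter.a = 2 from if_neg h,
      foldl_delta_replicate_b (by omega) (by omega)]
    split_ifs <;> omega

theorem foldl_delta_replicate_block {n q : ℕ} (hn : 3 ≤ n) (hq : 1 ≤ q) (hqn : q ≤ n) (k : ℕ) :
    (List.replicate k (Letter.a :: List.replicate (n - 2) Letter.b)).flatten.foldl (delta n) q =
      if q = n ∨ q ≤ k then n else q - k := by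
  induction k with
  | zero => simp; omega
  | succ k ih =>
    rw [List.replicate_succ', List.flatten_append, List.foldl_append, ih, List.flatten_singleton,
      foldl_delta_block hn (by split_ifs <;> omega) (by split_ifs <;> omega)]
    split_ifs <;> omega

theorem length_theWord {n : ℕ} (hn : 3 ≤ n) : (theWord n).length = n ^ 2 - 3 * n + 3 := by
  obtain ⟨m, rfl⟩ := Nat.exists_eq_add_of_le hn
  have h : (3 + m) ^ 2 - 3 * (3 + m) = m ^ 2 + 3 * m :=
    Nat.sub_eq_of_eq_add (by ring)
  rw [h]
  simp only [theWord, List.length_append, List.length_flatten, List.map_replicate,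
    List.sum_replicate, List.length_cons, List.length_replicate, List.length_nil, smul_eq_mul,
    show 3 + m - 2 = m + 1 by omega]
  ring

/-- The word `(a b^{n-2})^{n-2} a`, of length `(n-1)(n-2) + 1 = n² - 3n + 3`,
is a reset word for `𝒲ₙ`. -/
theorem wielandt_automaton_reset_word (n : ℕ) (hn : 3 ≤ n) :
    (theWord n).length = n ^ 2 - 3 * n + 3 ∧ IsReset n (theWord n) := by
  refine ⟨length_theWord hn, 2, fun q hq => ?_⟩
  obtain ⟨hq, hqn⟩ := Finset.mem_Icc.mp hq
  rw [theWord, List.foldl_append, foldl_delta_replicate_block hn hq hqn]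
  simp only [List.foldl_cons, List.foldl_nil, delta]
  split_ifs <;> omega
end

section
/- For every integer n ≥ 3, if w is a reset word of minimum length for the automaton 𝒲_n, then w sends every state to the state 2, i.e., δ(q,w) = 2 for all states q. -/
theorem delta_mem_Icc {n q : ℕ} (hn : 3 ≤ n) (hq : q ∈ Finset.Icc 1 n) (c : Letter) :
    delta n q c ∈ Finset.Icc 1 n := by
  rw [Finset.mem_Icc] at *
  cases c <;> simp only [delta] <;> split_ifs <;> omega

theorem foldl_delta_mem_Icc {n : ℕ} (hn : 3 ≤ n) (u : List Letter) {q : ℕ}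
    (hq : q ∈ Finset.Icc 1 n) : u.foldl (delta n) q ∈ Finset.Icc 1 n := by
  induction u generalizing q with
  | nil => exact hq
  | cons c u ih => exact ih (delta_mem_Icc hn hq c)

/-- The only pair of distinct states merged by a letter is `{1, n}`, and it is merged into `2`. -/
theorem eq_of_delta_eq {n x y : ℕ} {c : Letter} (hx : x ∈ Finset.Icc 1 n)
    (hy : y ∈ Finset.Icc 1 n) (hxy : delta n x c = delta n y c) (h2 : delta n x c ≠ 2) :
    x = y := by
  rw [Finset.mem_Icc] at hx hy
  cases c <;> simp only [delta] at hxy h2 <;> split_ifs at hxy h2 <;> omega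

/-- Every reset word of minimum length for `𝒲ₙ` sends every state to the state `2`. -/
theorem wielandt_min_reset_word_ends_at_two (n : ℕ) (hn : 3 ≤ n)
    (w : List Letter) (hw : IsReset n w)
    (hmin : ∀ v : List Letter, IsReset n v → w.length ≤ v.length) :
    ∀ q ∈ Finset.Icc 1 n, w.foldl (delta n) q = 2 := by
  obtain ⟨p, hp⟩ := hw
  have h1 : 1 ∈ Finset.Icc 1 n := Finset.mem_Icc.2 (by omega)
  suffices h : p = 2 from h ▸ hp
  by_contra hne
  rcases List.eq_nil_or_concat' w with rfl | ⟨u, c, rfl⟩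
  · have e1 := hp 1 h1
    have e2 := hp 2 (Finset.mem_Icc.2 (by omega))
    simp only [List.foldl_nil] at e1 e2
    omega
  · simp only [List.foldl_append, List.foldl_cons, List.foldl_nil] at hp
    have hu : IsReset n u := ⟨u.foldl (delta n) 1, fun q hq =>
      eq_of_delta_eq (foldl_delta_mem_Icc hn u hq) (foldl_delta_mem_Icc hn u h1)
        ((hp q hq).trans (hp 1 h1).symm) (hp q hq ▸ hne)⟩
    have := hmin u hu
    simp at this
end

section
/- For every integer n ≥ 3, every state q of the automaton 𝒲_n, and every nonempty word w over {a,b} with δ(q,w) = q, there exist non-negative integers α, β such that the length of w equals α·n + β·(n−1). -/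
/-- A step of `𝒲ₙ` keeps the states `≤ n`, and lowers `q + 1` by `0`, `n` or `n - 1`. -/
theorem delta_step {n q : ℕ} (hn : 2 ≤ n) (hq : q ≤ n) (c : Letter) :
    delta n q c ≤ n ∧ ∃ α β : ℕ, q + 1 = delta n q c + (α * n + β * (n - 1)) := by
  rcases hq.lt_or_eq with h | rfl
  · cases c <;> exact ⟨by simp [delta, h], 0, 0, by simp [delta, h]⟩
  · cases c
    · exact ⟨by simp [delta]; omega, 0, 1, by simp [delta]; omega⟩
    · exact ⟨by simp [delta]; omega, 1, 0, by simp [delta]; omega⟩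

/-- Along any path of `𝒲ₙ`, the start state plus the length exceeds the end state by a
non-negative integer combination of `n` and `n - 1`. -/
theorem add_length_eq_foldl_delta {n : ℕ} (hn : 2 ≤ n) (w : List Letter) {q : ℕ} (hq : q ≤ n) :
    ∃ α β : ℕ, q + w.length = w.foldl (delta n) q + (α * n + β * (n - 1)) := by
  induction w generalizing q with
  | nil => exact ⟨0, 0, by simp⟩
  | cons c w ih =>
    obtain ⟨hle, α, β, hstep⟩ := delta_step hn hq c
    obtain ⟨α', β', hpath⟩ := ih hle
    refine ⟨α + α', β + β', ?_⟩
    rw [List.length_cons, List.foldl_cons, add_mul, add_mul]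
    omega

/-- The length of any nonempty word labelling a cycle at a state of `𝒲ₙ` is a
non-negative integer combination of `n` and `n - 1`. -/
theorem wielandt_cycle_lengths (n : ℕ) (hn : 3 ≤ n)
    (q : ℕ) (hq : q ∈ Finset.Icc 1 n)
    (w : List Letter) (hne : w ≠ []) (hcyc : w.foldl (delta n) q = q) :
    ∃ α β : ℕ, w.length = α * n + β * (n - 1) := by
  obtain ⟨α, β, h⟩ := add_length_eq_foldl_delta (by omega : 2 ≤ n) w (Finset.mem_Icc.mp hq).2
  rw [hcyc] at h
  exact ⟨α, β, Nat.add_left_cancel h⟩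
end

section
/- For every integer n ≥ 3, there is no word w over {a,b} of length exactly n² − 3n + 2 such that δ(1,w) = 2 in the automaton 𝒲_n. -/
/-- Every walk of `𝒲ₙ` from state `1` to state `q` has length `q - 1` plus a nonnegative
combination of the two cycle lengths `n` and `n - 1`. -/
lemma length_of_foldl_delta {n : ℕ} (hn : 2 ≤ n) (w : List Letter) :
    w.foldl (delta n) 1 ≤ n ∧
      ∃ k l : ℕ, w.length + 1 = w.foldl (delta n) 1 + k * n + l * (n - 1) := by
  induction w using List.reverseRecOn with
  | nil => exact ⟨by simp only [List.foldl_nil]; omega, 0, 0, by simp⟩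
  | append_singleton w x ih =>
    obtain ⟨hq, k, l, h⟩ := ih
    simp only [List.foldl_append, List.foldl_cons, List.foldl_nil, List.length_append,
      List.length_singleton]
    generalize w.foldl (delta n) 1 = q at *
    by_cases hlt : q < n
    · have hstep : delta n q x = q + 1 := by cases x <;> simp [delta, hlt]
      rw [hstep]
      exact ⟨hlt, k, l, by omega⟩
    · cases x
      · simp only [delta, hlt, if_false]
        exact ⟨hn, k, l + 1, by rw [add_one_mul]; omega⟩
      · simp only [delta, hlt, if_false]
        exact ⟨by omega, k + 1, l, by rw [add_one_mul]; omega⟩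

/-- There is no word of length `n² - 3n + 2` sending state `1` to state `2` in `𝒲ₙ`. -/
theorem wielandt_no_path (n : ℕ) (hn : 3 ≤ n) :
    ¬ ∃ w : List Letter, w.length = n ^ 2 - 3 * n + 2 ∧ w.foldl (delta n) 1 = 2 := by
  rintro ⟨w, hlen, hw⟩
  obtain ⟨-, k, l, h⟩ := length_of_foldl_delta (by omega : 2 ≤ n) w
  rw [hw, hlen] at h
  have hfrob := (frobeniusNumber_pair (m := n) (n := n - 1)
    ((Nat.coprime_self_sub_right (by omega : 1 ≤ n)).2 (Nat.coprime_one_right n))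
    (by omega) (by omega)).1
  refine hfrob ((AddSubmonoid.mem_closure_pair _ _ _).2 ⟨k, l, ?_⟩)
  obtain ⟨m, rfl⟩ : ∃ m, n = m + 3 := ⟨n - 3, by omega⟩
  have hsq : (m + 3) ^ 2 = m * m + 6 * m + 9 := by ring
  have hmul : (m + 3) * (m + 3 - 1) = m * m + 5 * m + 6 := by
    rw [show m + 3 - 1 = m + 2 by omega]; ring
  rw [hsq] at h
  rw [hmul, smul_eq_mul, smul_eq_mul]
  omega
end
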